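/- arXiv:1411.6498 — 11 statements merged into one kernel-verified Lean document; each statement's English description precedes it below -/
import Mathlib

section
/- Let a, u, t be integers with u ≥ 1 and let ρ be a real number with 1/2 < ρ ≤ 1 ≤ a. If 2^{t−u}·((2ρ−1)·2^{u−1} − (a−ρ)) ≥ 2, then for all integers d with 1 ≤ d ≤ a and all integers k with 2^{u−1} ≤ k < 2^u, one has ⌈2^{t−u}(d−ρ)(k+1) + 1⌉ ≤ ⌊2^{t−u}(d+ρ−1)k⌋; that is, the pair (u,t) is valid for (a,ρ). -/
/-- If the strong slack condition
`2^(t-u) * ((2ρ-1)·2^(u-1) - (a-ρ)) ≥ 2` holds, then `(u,t)` is valid for `(a,ρ)`. -/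
theorem srt_strong_condition_valid
    (a u t : ℤ) (ρ : ℝ) (hu : 1 ≤ u)
    (hρ₁ : 1 / 2 < ρ) (hρ₂ : ρ ≤ 1) (ha : (1 : ℝ) ≤ (a : ℝ))
    (h : (2 : ℝ) ^ (t - u) * ((2 * ρ - 1) * (2 : ℝ) ^ (u - 1) - ((a : ℝ) - ρ)) ≥ 2) :
    ∀ d k : ℤ, 1 ≤ d → d ≤ a →
      (2 : ℤ) ^ (u - 1).toNat ≤ k → k < (2 : ℤ) ^ u.toNat →
      ⌈(2 : ℝ) ^ (t - u) * ((d : ℝ) - ρ) * ((k : ℝ) + 1) + 1⌉ ≤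
        ⌊(2 : ℝ) ^ (t - u) * ((d : ℝ) + ρ - 1) * (k : ℝ)⌋ := by
  intro d k _ hda hk _
  have hk' : (2 : ℝ) ^ (u - 1) ≤ (k : ℝ) := by
    have hu' : (((u - 1).toNat : ℕ) : ℤ) = u - 1 := Int.toNat_of_nonneg (by lia)
    rw [← hu', zpow_natCast]
    exact_mod_cast hk
  have hda' : (d : ℝ) ≤ a := by exact_mod_cast hda
  have hc : (0 : ℝ) < 2 ^ (t - u) := by positivity
  have slack : (2 * ρ - 1) * (2 : ℝ) ^ (u - 1) - ((a : ℝ) - ρ) ≤ (2 * ρ - 1) * k - (d - ρ) := by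
    have := mul_le_mul_of_nonneg_left hk' (by linarith : 0 ≤ 2 * ρ - 1)
    linarith
  have gap := mul_le_mul_of_nonneg_left slack hc.le
  rw [Int.le_floor]
  refine (Int.ceil_lt_add_one _).le.trans ?_
  linarith
end

section
/- Let a, u, t be integers with u ≥ 1 and let ρ be a real number with 1/2 < ρ ≤ 1 ≤ a. If the weak condition 2^{−t} ≤ (ρ − 1/2) − (a−ρ)·2^{−u} holds, then the pair (u, t+1) is valid for (a,ρ): for all integers d with 1 ≤ d ≤ a and all integers k with 2^{u−1} ≤ k < 2^u, Δ(t+1,u,d,ρ,k) ≥ 0. -/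
/-- The difference `Δ(t,u,d,ρ,k) = ⌊2^(t-u)(d+ρ-1)k⌋ - ⌈2^(t-u)(d-ρ)(k+1) + 1⌉`. -/
noncomputable def srtDelta (t u d : ℤ) (ρ : ℝ) (k : ℤ) : ℤ :=
  ⌊(2 : ℝ) ^ (t - u) * ((d : ℝ) + ρ - 1) * (k : ℝ)⌋ -
    ⌈(2 : ℝ) ^ (t - u) * ((d : ℝ) - ρ) * ((k : ℝ) + 1) + 1⌉

theorem Int.ceil_le_floor_of_add_one_le {R : Type*} [Ring R] [LinearOrder R]
    [IsStrictOrderedRing R] [FloorRing R] {x y : R} (h : x + 1 ≤ y) : ⌈x⌉ ≤ ⌊y⌋ :=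
  Int.ceil_le.2 ((le_sub_iff_add_le.2 h).trans (Int.sub_one_lt_floor y).le)

/-- If the weak condition `2^(-t) ≤ (ρ - 1/2) - (a-ρ)·2^(-u)` holds,
then `(u, t+1)` is valid for `(a,ρ)`. -/
theorem srt_weak_condition_succ_valid
    (a u t : ℤ) (ρ : ℝ) (hu : 1 ≤ u)
    (hρ₁ : 1 / 2 < ρ) (hρ₂ : ρ ≤ 1) (ha : (1 : ℝ) ≤ (a : ℝ))
    (h : (2 : ℝ) ^ (-t) ≤ (ρ - 1 / 2) - ((a : ℝ) - ρ) * (2 : ℝ) ^ (-u)) :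
    ∀ d k : ℤ, 1 ≤ d → d ≤ a →
      (2 : ℤ) ^ (u - 1).toNat ≤ k → k < (2 : ℤ) ^ u.toNat →
      0 ≤ srtDelta (t + 1) u d ρ k := by
  intro d k _ hda hk _
  have hS : (0 : ℝ) < (2 : ℝ) ^ (t + 1 - u) := by positivity
  have hT : (0 : ℝ) < (2 : ℝ) ^ (t + 1) := by positivity
  have hda' : (d : ℝ) ≤ a := by exact_mod_cast hda
  have hk' : (2 : ℝ) ^ (u - 1) ≤ k := by
    rw [← Int.toNat_of_nonneg (sub_nonneg.2 hu), zpow_natCast]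
    exact_mod_cast hk
  have hinv : (2 : ℝ) ^ (t + 1) * (2 : ℝ) ^ (-t) = 2 := by
    rw [← zpow_add₀ two_ne_zero, show t + 1 + -t = 1 by ring, zpow_one]
  have hsplit : (2 : ℝ) ^ (t + 1) * (2 : ℝ) ^ (-u) = (2 : ℝ) ^ (t + 1 - u) := by
    rw [← zpow_add₀ two_ne_zero, sub_eq_add_neg]
  have hhalf : (2 : ℝ) ^ (t + 1) = 2 * ((2 : ℝ) ^ (t + 1 - u) * (2 : ℝ) ^ (u - 1)) := by
    rw [← zpow_add₀ two_ne_zero, ← zpow_one_add₀ two_ne_zero]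
    congr 1
    ring
  have hscaled := mul_le_mul_of_nonneg_left h hT.le
  have hmono : (2 * ρ - 1) * (2 : ℝ) ^ (u - 1) - (a - ρ) ≤ (2 * ρ - 1) * k - (d - ρ) := by
    have := mul_le_mul_of_nonneg_left hk' (show 0 ≤ 2 * ρ - 1 by linarith)
    linarith
  have hgap := mul_le_mul_of_nonneg_left hmono hS.le
  rw [srtDelta, sub_nonneg]
  apply Int.ceil_le_floor_of_add_one_le
  have hexpand : (2 : ℝ) ^ (t + 1) * ((ρ - 1 / 2) - (a - ρ) * (2 : ℝ) ^ (-u)) =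
      (2 : ℝ) ^ (t + 1 - u) * ((2 * ρ - 1) * (2 : ℝ) ^ (u - 1) - (a - ρ)) := by
    linear_combination (ρ - 1 / 2) * hhalf - (a - ρ) * hsplit
  linarith
end

section
/- Let a, u, t be integers with u ≥ 1 and let ρ be a real number with 1/2 < ρ ≤ 1 ≤ a and a > ρ. If 2^{1−t} < ρ − 1/2 and 2^{−u} ≤ (ρ − 1/2 − 2^{1−t})/(a − ρ), then δ_{k,d} = 2^{t−u}((2ρ−1)k − (d−ρ)) − 1 satisfies δ_{k,d} ≥ 1 for k = 2^{u−1} and d = a, and consequently Δ(t,u,d,ρ,k) ≥ 0 for ALL integers k ≥ 2^{u−1} (not only k < 2^u) and all integers d with 1 ≤ d ≤ a. -/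
/-- A slack of at least `1` absorbs the rounding of the floor and the ceiling. -/
theorem srtDelta_nonneg_of_one_le_slack {t u d k : ℤ} {ρ : ℝ}
    (h : 1 ≤ (2 : ℝ) ^ (t - u) * ((2 * ρ - 1) * (k : ℝ) - ((d : ℝ) - ρ)) - 1) :
    0 ≤ srtDelta t u d ρ k := by
  have hfloor := Int.lt_floor_add_one ((2 : ℝ) ^ (t - u) * ((d : ℝ) + ρ - 1) * (k : ℝ))
  have hceil := Int.ceil_lt_add_one ((2 : ℝ) ^ (t - u) * ((d : ℝ) - ρ) * ((k : ℝ) + 1) + 1)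
  have hlt : (-1 : ℝ) < (srtDelta t u d ρ k : ℤ) := by
    rw [srtDelta]
    push_cast
    linarith
  have : -1 < srtDelta t u d ρ k := by exact_mod_cast hlt
  omega

/-- The slack increases with `k` and decreases with `d`. -/
theorem srt_slack_mono {t u : ℤ} {ρ k₁ k₂ d₁ d₂ : ℝ} (hρ : 1 / 2 ≤ ρ)
    (hk : k₁ ≤ k₂) (hd : d₂ ≤ d₁) :
    (2 : ℝ) ^ (t - u) * ((2 * ρ - 1) * k₁ - (d₁ - ρ)) - 1 ≤
      (2 : ℝ) ^ (t - u) * ((2 * ρ - 1) * k₂ - (d₂ - ρ)) - 1 := by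
  have : 0 ≤ 2 * ρ - 1 := by linarith
  gcongr

/-- under `2^(1-t) < ρ - 1/2` and `2^(-u) ≤ (ρ - 1/2 - 2^(1-t))/(a - ρ)`,
the slack `δ_{k,d}` at `k = 2^(u-1)`, `d = a` is at least `1`, and `Δ(t,u,d,ρ,k) ≥ 0`
for all `k ≥ 2^(u-1)` and all `1 ≤ d ≤ a`. -/
theorem srt_slack_ge_one_all_k
    (a u t : ℤ) (ρ : ℝ) (hu : 1 ≤ u)
    (hρ₁ : 1 / 2 < ρ) (hρ₂ : ρ ≤ 1) (ha : (1 : ℝ) ≤ (a : ℝ)) (haρ : ρ < (a : ℝ))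
    (ht : (2 : ℝ) ^ (1 - t) < ρ - 1 / 2)
    (hu' : (2 : ℝ) ^ (-u) ≤ (ρ - 1 / 2 - (2 : ℝ) ^ (1 - t)) / ((a : ℝ) - ρ)) :
    ((2 : ℝ) ^ (t - u) * ((2 * ρ - 1) * (2 : ℝ) ^ (u - 1) - ((a : ℝ) - ρ)) - 1 ≥ 1) ∧
    (∀ d k : ℤ, 1 ≤ d → d ≤ a → (2 : ℤ) ^ (u - 1).toNat ≤ k →
      0 ≤ srtDelta t u d ρ k) := by
  have hT : (0 : ℝ) < 2 ^ t := by positivity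
  have hslack : (2 : ℝ) ^ (t - u) * ((2 * ρ - 1) * (2 : ℝ) ^ (u - 1) - ((a : ℝ) - ρ)) - 1 ≥ 1 := by
    rw [le_div_iff₀ (sub_pos.2 haρ), zpow_neg, zpow_sub₀ two_ne_zero, zpow_one] at hu'
    rw [zpow_sub₀ two_ne_zero, zpow_sub₀ two_ne_zero, zpow_one]
    have h := mul_le_mul_of_nonneg_left hu' hT.le
    have h₁ : (2 : ℝ) ^ t * (ρ - 1 / 2 - 2 / 2 ^ t) = 2 ^ t * (ρ - 1 / 2) - 2 := by
      field_simp
    have h₂ : (2 : ℝ) ^ t / 2 ^ u * ((2 * ρ - 1) * (2 ^ u / 2) - (a - ρ)) =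
        2 ^ t * (ρ - 1 / 2) - 2 ^ t * ((2 ^ u)⁻¹ * (a - ρ)) := by
      field_simp
    linarith
  refine ⟨hslack, fun d k _ hda hk => ?_⟩
  have hda' : (d : ℝ) ≤ a := by exact_mod_cast hda
  have hk' : (2 : ℝ) ^ (u - 1) ≤ k := by
    rw [← Int.toNat_of_nonneg (sub_nonneg.2 hu), zpow_natCast]
    exact_mod_cast hk
  exact srtDelta_nonneg_of_one_le_slack (hslack.trans (srt_slack_mono hρ₁.le hk' hda'))
end

section
/- For radix 16 with the maximally redundant digit set (a = 15, ρ = 1), the pair (u,t) = (6,3) is valid: for all integers d with 1 ≤ d ≤ 15 and all integers k with 32 ≤ k < 64, ⌊2^{−3}·d·k⌋ ≥ ⌈2^{−3}·(d−1)·(k+1) + 1⌉. -/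
/-- radix 16, maximally redundant (`a = 15`, `ρ = 1`), `(u,t) = (6,3)` is valid. -/
theorem srt_radix16_u6_t3_valid :
    ∀ d k : ℤ, 1 ≤ d → d ≤ 15 → 32 ≤ k → k < 64 →
      ⌈(2 : ℝ) ^ (-3 : ℤ) * ((d : ℝ) - 1) * ((k : ℝ) + 1) + 1⌉ ≤
        ⌊(2 : ℝ) ^ (-3 : ℤ) * (d : ℝ) * (k : ℝ)⌋ := by
  intro d k _ hd hk _
  have h8 : (2 : ℝ) ^ (-3 : ℤ) = 1 / 8 := by norm_num
  rw [h8]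
  have hlo : 8 * (d * k / 8) ≤ d * k := by omega
  have hhi : (d - 1) * (k + 1) + 8 ≤ 8 * (d * k / 8) := by
    have : d * k ≤ 8 * (d * k / 8) + 7 := by omega
    linarith
  have hloR : (8 : ℝ) * ((d * k / 8 : ℤ) : ℝ) ≤ d * k := by exact_mod_cast hlo
  have hhiR : ((d : ℝ) - 1) * (k + 1) + 8 ≤ 8 * ((d * k / 8 : ℤ) : ℝ) := by exact_mod_cast hhi
  exact (Int.ceil_le.2 (by linarith)).trans (Int.le_floor.2 (by linarith) : d * k / 8 ≤ _)
end

section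
/- For radix 32 with the maximally redundant digit set (a = 31, ρ = 1), the pair (u,t) = (7,3) is valid: for all integers d with 1 ≤ d ≤ 31 and all integers k with 64 ≤ k < 128, ⌊2^{−4}·d·k⌋ ≥ ⌈2^{−4}·(d−1)·(k+1) + 1⌉. -/
/-- radix 32, maximally redundant (`a = 31`, `ρ = 1`), `(u,t) = (7,3)` is valid. -/
theorem srt_radix32_u7_t3_valid :
    ∀ d k : ℤ, 1 ≤ d → d ≤ 31 → 64 ≤ k → k < 128 →
      ⌈(2 : ℝ) ^ (-4 : ℤ) * ((d : ℝ) - 1) * ((k : ℝ) + 1) + 1⌉ ≤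
        ⌊(2 : ℝ) ^ (-4 : ℤ) * (d : ℝ) * (k : ℝ)⌋ := by
  intro d k _ hd hk _
  have hpow : (2 : ℝ) ^ (-4 : ℤ) = 1 / 16 := by norm_num [zpow_neg]
  rw [hpow]
  have hlower : 16 * (d * k / 16) ≤ d * k := by omega
  have hupper : (d - 1) * (k + 1) + 16 ≤ 16 * (d * k / 16) := by
    have hexpand : (d - 1) * (k + 1) = d * k + d - k - 1 := by ring
    omega
  have hlower' : (16 : ℝ) * ((d * k / 16 : ℤ) : ℝ) ≤ d * k := by exact_mod_cast hlower
  have hupper' : ((d : ℝ) - 1) * (k + 1) + 16 ≤ 16 * ((d * k / 16 : ℤ) : ℝ) := by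
    exact_mod_cast hupper
  calc _ ≤ d * k / 16 := Int.ceil_le.mpr (by linarith)
    _ ≤ _ := Int.le_floor.mpr (by linarith)
end

section
/- (Theorem 1, corrected SRT digit selection constants.) Let β = 2^p with p ≥ 2, let a be an integer with β/2 ≤ a ≤ β−1, and set ρ = a/(β−1) (so 1/2 < ρ ≤ 1). Let u be an integer satisfying 2^{−u} < (ρ − 1/2)/(a − ρ), and let t̂ be the smallest integer t satisfying 2^{−t} ≤ (ρ − 1/2) − (a − ρ)·2^{−u}. Define t = t̂ if Δ(t̂,u,d,ρ,k) ≥ 0 for all integers d with 1 ≤ d ≤ a and all integers k with 2^{u−1} ≤ k < 2^u, and t = t̂ + 1 otherwise. Then the pair (u,t) is valid for (a,ρ), i.e., Δ(t,u,d,ρ,k) ≥ 0 for all integers d with 1 ≤ d ≤ a and all integers k with 2^{u−1} ≤ k < 2^u. -/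
/-- `(u,t)` is valid for `(a,ρ)`. -/
def srtValid (u t a : ℤ) (ρ : ℝ) : Prop :=
  ∀ d k : ℤ, 1 ≤ d → d ≤ a →
    (2 : ℤ) ^ (u - 1).toNat ≤ k → k < (2 : ℤ) ^ u.toNat →
    0 ≤ srtDelta t u d ρ k

/-- If `y + 2 ≤ x`, then rounding `x` down and `y + 1` up preserves their order. -/
theorem floor_sub_ceil_add_one_nonneg {x y : ℝ} (h : y + 2 ≤ x) : 0 ≤ ⌊x⌋ - ⌈y + 1⌉ := by
  have h₁ := Int.lt_floor_add_one x
  have h₂ := Int.ceil_lt_add_one (y + 1)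
  have h₃ : ((⌈y + 1⌉ : ℤ) : ℝ) < (⌊x⌋ : ℝ) + 1 := by linarith
  have h₄ : ⌈y + 1⌉ < ⌊x⌋ + 1 := by exact_mod_cast h₃
  omega

/-- Validity holds once the width of the narrowest selection interval is at least `2 * 2 ^ (-t)`. -/
theorem srtValid_of_two_mul_zpow_le {u t a : ℤ} {ρ : ℝ} (hρ : 1 / 2 ≤ ρ)
    (h : 2 * (2 : ℝ) ^ (-t) ≤ (ρ - 1 / 2) - ((a : ℝ) - ρ) * (2 : ℝ) ^ (-u)) :
    srtValid u t a ρ := by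
  intro d k _ hda hk₁ hk₂
  have hu : 1 ≤ u := by
    by_contra! hu
    have h₁ : (u - 1).toNat = 0 := by omega
    have h₂ : u.toNat = 0 := by omega
    rw [h₁] at hk₁
    rw [h₂] at hk₂
    omega
  have hk : (2 : ℝ) ^ u ≤ 2 * k := by
    have h₁ : (2 : ℤ) ^ u.toNat ≤ 2 * k := by
      have h₂ : u.toNat = (u - 1).toNat + 1 := by omega
      rw [h₂, pow_succ]
      linarith
    rw [← Int.toNat_of_nonneg (by omega : 0 ≤ u), zpow_natCast]
    exact_mod_cast h₁
  have hd : (d : ℝ) ≤ a := by exact_mod_cast hda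
  have hu₀ : (0 : ℝ) < (2 : ℝ) ^ (-u) := by positivity
  have ht₀ : (0 : ℝ) < (2 : ℝ) ^ t := by positivity
  have hun : (2 : ℝ) ^ u * (2 : ℝ) ^ (-u) = 1 := by
    rw [← zpow_add₀ two_ne_zero]; simp
  have htn : (2 : ℝ) ^ t * (2 : ℝ) ^ (-t) = 1 := by
    rw [← zpow_add₀ two_ne_zero]; simp
  have htu : (2 : ℝ) ^ (t - u) = (2 : ℝ) ^ t * (2 : ℝ) ^ (-u) := by
    rw [sub_eq_add_neg, zpow_add₀ two_ne_zero]
  have hwidth : (2 : ℝ) * (2 : ℝ) ^ (-t) ≤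
      (2 : ℝ) ^ (-u) * ((2 * ρ - 1) * k - (d - ρ)) := by
    have h₁ : (ρ - 1 / 2) * (2 : ℝ) ^ u ≤ (ρ - 1 / 2) * (2 * k) :=
      mul_le_mul_of_nonneg_left hk (by linarith)
    have h₂ : (2 : ℝ) ^ (-u) * ((ρ - 1 / 2) * (2 : ℝ) ^ u - (a - ρ)) ≤
        (2 : ℝ) ^ (-u) * ((2 * ρ - 1) * k - (d - ρ)) :=
      mul_le_mul_of_nonneg_left (by linarith) hu₀.le
    linear_combination h + h₂ - (ρ - 1 / 2) * hun
  have hscaled := mul_le_mul_of_nonneg_left hwidth ht₀.le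
  apply floor_sub_ceil_add_one_nonneg
  rw [htu]
  linear_combination hscaled - 2 * htn

/-- Theorem 1, corrected SRT digit selection constants. -/
theorem srt_corrected_theorem
    (p : ℕ) (hp : 2 ≤ p) (a : ℤ)
    (ha₁ : (2 : ℤ) ^ (p - 1) ≤ a) (ha₂ : a ≤ (2 : ℤ) ^ p - 1)
    (ρ : ℝ) (hρ : ρ = (a : ℝ) / ((2 : ℝ) ^ p - 1))
    (u : ℤ) (hu : (2 : ℝ) ^ (-u) < (ρ - 1 / 2) / ((a : ℝ) - ρ))
    (tHat : ℤ)
    (htHat : IsLeast {t : ℤ | (2 : ℝ) ^ (-t) ≤ (ρ - 1 / 2) - ((a : ℝ) - ρ) * (2 : ℝ) ^ (-u)} tHat)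
    (t : ℤ)
    (htdef : (srtValid u tHat a ρ ∧ t = tHat) ∨ (¬ srtValid u tHat a ρ ∧ t = tHat + 1)) :
    srtValid u t a ρ := by
  rcases htdef with ⟨h, rfl⟩ | ⟨-, rfl⟩
  · exact h
  · have hβ : (4 : ℝ) ≤ (2 : ℝ) ^ p := by
      calc (4 : ℝ) = 2 ^ 2 := by norm_num
        _ ≤ 2 ^ p := pow_le_pow_right₀ one_le_two hp
    have ha : (2 : ℝ) ^ p ≤ 2 * a := by
      have h₁ : (2 : ℤ) ^ p = 2 * 2 ^ (p - 1) := by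
        rw [← pow_succ', Nat.sub_add_cancel (by omega)]
      have h₂ : (2 : ℤ) ^ p ≤ 2 * a := by linarith
      exact_mod_cast h₂
    have hρ₂ : 1 / 2 ≤ ρ := by
      rw [hρ, le_div_iff₀ (by linarith)]
      linarith
    refine srtValid_of_two_mul_zpow_le hρ₂ (le_of_eq_of_le ?_ htHat.1)
    rw [neg_add, zpow_add₀ two_ne_zero, zpow_neg_one]
    ring
end

section
/- (Theorem 2, first parameter set.) Let p ≥ 2 be an integer, β = 2^p, and consider the maximally redundant digit set with a = 2^p − 1 and ρ = 1. Then the pair (u,t) = (p+1, p) is valid for (a,1): for all integers d with 1 ≤ d ≤ 2^p − 1 and all integers k with 2^p ≤ k < 2^{p+1}, one has ⌊d·k/2⌋ ≥ ⌈(d−1)(k+1)/2 + 1⌉. -/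
/-- Theorem 2, first parameter set: for `β = 2^p`, `a = 2^p - 1`, `ρ = 1`,
the pair `(u,t) = (p+1, p)` is valid. -/
theorem srt_maxred_first_params (p : ℕ) (hp : 2 ≤ p) :
    ∀ d k : ℤ, 1 ≤ d → d ≤ 2 ^ p - 1 →
      (2 : ℤ) ^ p ≤ k → k < (2 : ℤ) ^ (p + 1) →
      ⌈((d : ℝ) - 1) * ((k : ℝ) + 1) / 2 + 1⌉ ≤ ⌊(d : ℝ) * (k : ℝ) / 2⌋ := by
  intro d k _ hd hk _
  obtain ⟨n, hn₁, hn₂⟩ : ∃ n : ℤ, (d - 1) * (k + 1) + 2 ≤ 2 * n ∧ 2 * n ≤ d * k := by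
    have hgap : (d - 1) * (k + 1) + 2 = d * k - (k - d - 1) := by ring
    rcases (show d + 1 ≤ k by linarith).eq_or_lt with h | h
    · -- The gap closes only at `d = 2 ^ p - 1`, `k = 2 ^ p`, where `k` is even.
      have hkp : k = 2 ^ p := by linarith
      obtain ⟨m, hm⟩ : (2 : ℤ) ∣ k := hkp ▸ dvd_pow_self 2 (by omega)
      have hdk : d * k = 2 * (d * m) := by rw [hm]; ring
      exact ⟨d * m, by omega, by omega⟩
    · exact ⟨d * k / 2, by omega, by omega⟩
  have hn₁' : ((d : ℝ) - 1) * (k + 1) + 2 ≤ 2 * n := by exact_mod_cast hn₁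
  have hn₂' : 2 * (n : ℝ) ≤ d * k := by exact_mod_cast hn₂
  exact ((Int.ceil_le (z := n)).mpr (by linarith)).trans (Int.le_floor.mpr (by linarith))
end

section
/- (Theorem 2, second parameter set.) Let p > 2 be an integer, β = 2^p, and consider the maximally redundant digit set with a = 2^p − 1 and ρ = 1. Then the pair (u,t) = (p+2, 3) is valid for (a,1): for all integers d with 1 ≤ d ≤ 2^p − 1 and all integers k with 2^{p+1} ≤ k < 2^{p+2}, one has ⌊2^{1−p}·d·k⌋ ≥ ⌈2^{1−p}·(d−1)·(k+1) + 1⌉. -/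
/-- Theorem 2, second parameter set: for `β = 2^p`, `p > 2`, `a = 2^p - 1`,
`ρ = 1`, the pair `(u,t) = (p+2, 3)` is valid. -/
theorem srt_maxred_second_params (p : ℕ) (hp : 2 < p) :
    ∀ d k : ℤ, 1 ≤ d → d ≤ 2 ^ p - 1 →
      (2 : ℤ) ^ (p + 1) ≤ k → k < (2 : ℤ) ^ (p + 2) →
      ⌈(2 : ℝ) ^ (1 - (p : ℤ)) * ((d : ℝ) - 1) * ((k : ℝ) + 1) + 1⌉ ≤
        ⌊(2 : ℝ) ^ (1 - (p : ℤ)) * (d : ℝ) * (k : ℝ)⌋ := by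
  intro d k _ hd hk _
  have hc : (2 : ℝ) ^ (1 - (p : ℤ)) * 2 ^ p = 2 := by
    rw [← zpow_natCast, ← zpow_add₀ two_ne_zero, sub_add_cancel, zpow_one]
  have hc0 : (0 : ℝ) < (2 : ℝ) ^ (1 - (p : ℤ)) := by positivity
  have hgap : (2 : ℝ) ^ p ≤ k - d + 1 := by
    have h : (2 : ℤ) ^ p ≤ k - d + 1 := by
      rw [pow_succ] at hk
      linarith
    exact_mod_cast h
  have hmul := mul_le_mul_of_nonneg_left hgap hc0.le
  have hfloor := Int.lt_floor_add_one ((2 : ℝ) ^ (1 - (p : ℤ)) * (d : ℝ) * (k : ℝ))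
  rw [Int.ceil_le]
  linarith
end

section
/- Let p > 2 be an integer and consider the maximally redundant digit set with a = 2^p − 1 and ρ = 1. Then for d = 2^p − 1 and k = 2^{p+1} + 2 one has ⌊2^{−p}·d·k⌋ − ⌈2^{−p}·(d−1)·(k+1) + 1⌉ = −1; in particular, Δ(2, p+2, a, 1, k) < 0, so the pair (u,t) = (p+2, 2) is NOT valid for (a,1). -/
/-- for `p > 2`, `d = 2^p - 1` and `k = 2^(p+1) + 2`,
`⌊2^(-p)·d·k⌋ - ⌈2^(-p)·(d-1)·(k+1) + 1⌉ = -1`, so `(u,t) = (p+2, 2)` is not valid. -/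
theorem srt_maxred_t2_fails (p : ℕ) (hp : 2 < p) :
    ⌊(2 : ℝ) ^ (-(p : ℤ)) * ((2 : ℝ) ^ p - 1) * ((2 : ℝ) ^ (p + 1) + 2)⌋ -
      ⌈(2 : ℝ) ^ (-(p : ℤ)) * (((2 : ℝ) ^ p - 1) - 1) * (((2 : ℝ) ^ (p + 1) + 2) + 1) + 1⌉
      = -1 := by
  have hB : (8 : ℝ) ≤ 2 ^ p := by
    calc (8 : ℝ) = 2 ^ 3 := by norm_num
      _ ≤ 2 ^ p := pow_le_pow_right₀ (by norm_num) hp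
  have hpos : (0 : ℝ) < 2 ^ p := by positivity
  have hinv : (0 : ℝ) < ((2 : ℝ) ^ p)⁻¹ := by positivity
  have hinv_le : ((2 : ℝ) ^ p)⁻¹ ≤ 8⁻¹ := inv_anti₀ (by norm_num) hB
  have hfloor : ⌊(2 : ℝ) ^ (-(p : ℤ)) * ((2 : ℝ) ^ p - 1) * ((2 : ℝ) ^ (p + 1) + 2)⌋ =
      2 * 2 ^ p - 1 := by
    have h : (2 : ℝ) ^ (-(p : ℤ)) * ((2 : ℝ) ^ p - 1) * ((2 : ℝ) ^ (p + 1) + 2) =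
        2 * 2 ^ p - 2 * ((2 : ℝ) ^ p)⁻¹ := by
      rw [zpow_neg, zpow_natCast, pow_succ]
      field_simp
      ring
    rw [h, Int.floor_eq_iff]
    push_cast
    constructor <;> linarith
  have hceil : ⌈(2 : ℝ) ^ (-(p : ℤ)) * (((2 : ℝ) ^ p - 1) - 1) *
      (((2 : ℝ) ^ (p + 1) + 2) + 1) + 1⌉ = 2 * 2 ^ p := by
    have h : (2 : ℝ) ^ (-(p : ℤ)) * (((2 : ℝ) ^ p - 1) - 1) *
        (((2 : ℝ) ^ (p + 1) + 2) + 1) + 1 = 2 * 2 ^ p - 6 * ((2 : ℝ) ^ p)⁻¹ := by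
      rw [zpow_neg, zpow_natCast, pow_succ]
      field_simp
      ring
    rw [h, Int.ceil_eq_iff]
    push_cast
    constructor <;> linarith
  rw [hfloor, hceil]
  ring
end

section
/- For radix 16 with the minimally redundant digit set a = 8 and ρ = 8/15, the pair (u,t) = (9,7) is valid: for all integers d with 1 ≤ d ≤ 8 and all integers k with 256 ≤ k < 512, one has ⌊2^{−2}·(d + 8/15 − 1)·k⌋ ≥ ⌈2^{−2}·(d − 8/15)·(k+1) + 1⌉. -/
/-- radix 16, minimally redundant (`a = 8`, `ρ = 8/15`),
`(u,t) = (9,7)` is valid. -/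
theorem srt_radix16_minred_valid :
    ∀ d k : ℤ, 1 ≤ d → d ≤ 8 → 256 ≤ k → k < 512 →
      ⌈(2 : ℝ) ^ (-2 : ℤ) * ((d : ℝ) - 8 / 15) * ((k : ℝ) + 1) + 1⌉ ≤
        ⌊(2 : ℝ) ^ (-2 : ℤ) * ((d : ℝ) + 8 / 15 - 1) * (k : ℝ)⌋ := by
  intro d k _ hd hk _
  have hd' : (d : ℝ) ≤ 8 := by exact_mod_cast hd
  have hk' : (256 : ℝ) ≤ k := by exact_mod_cast hk
  refine Int.le_floor.mpr ((Int.ceil_lt_add_one _).le.trans ?_)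
  norm_num
  linarith
end

section
/- Let a, u, t be integers with u ≥ 1 and let ρ be a real number with 1/2 < ρ ≤ 1 ≤ a. If the pair (u,t) is valid for (a,ρ), then both (u, t+1) and (u+1, t) are valid for (a,ρ): Δ(t+1,u,d,ρ,k) ≥ 0 for all 1 ≤ d ≤ a and 2^{u−1} ≤ k < 2^u, and Δ(t,u+1,d,ρ,k) ≥ 0 for all 1 ≤ d ≤ a and 2^u ≤ k < 2^{u+1}. -/
/-- `Δ` is nonnegative iff some integer lies between the two bounds defining it. -/
theorem srtDelta_nonneg_iff (t u d : ℤ) (ρ : ℝ) (k : ℤ) :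
    0 ≤ srtDelta t u d ρ k ↔
      ∃ m : ℤ, (2 : ℝ) ^ (t - u) * ((d : ℝ) - ρ) * ((k : ℝ) + 1) + 1 ≤ m ∧
        (m : ℝ) ≤ (2 : ℝ) ^ (t - u) * ((d : ℝ) + ρ - 1) * (k : ℝ) := by
  unfold srtDelta
  rw [sub_nonneg]
  constructor
  · intro h
    exact ⟨_, Int.le_ceil _, Int.le_floor.mp h⟩
  · rintro ⟨m, h₁, h₂⟩
    exact (Int.ceil_le.mpr h₁).trans (Int.le_floor.mpr h₂)

/-- if `(u,t)` is valid for `(a,ρ)`, so are `(u, t+1)` and `(u+1, t)`. -/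
theorem srt_valid_monotone
    (a u t : ℤ) (ρ : ℝ) (hu : 1 ≤ u)
    (hρ₁ : 1 / 2 < ρ) (hρ₂ : ρ ≤ 1) (ha : (1 : ℝ) ≤ (a : ℝ))
    (hvalid : ∀ d k : ℤ, 1 ≤ d → d ≤ a →
      (2 : ℤ) ^ (u - 1).toNat ≤ k → k < (2 : ℤ) ^ u.toNat →
      0 ≤ srtDelta t u d ρ k) :
    (∀ d k : ℤ, 1 ≤ d → d ≤ a →
      (2 : ℤ) ^ (u - 1).toNat ≤ k → k < (2 : ℤ) ^ u.toNat →
      0 ≤ srtDelta (t + 1) u d ρ k) ∧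
    (∀ d k : ℤ, 1 ≤ d → d ≤ a →
      (2 : ℤ) ^ u.toNat ≤ k → k < (2 : ℤ) ^ (u + 1).toNat →
      0 ≤ srtDelta t (u + 1) d ρ k) := by
  constructor
  · intro d k hd hda hk hk'
    obtain ⟨m, h₁, h₂⟩ := (srtDelta_nonneg_iff ..).mp (hvalid d k hd hda hk hk')
    have hc : (2 : ℝ) ^ (t + 1 - u) = 2 * 2 ^ (t - u) := by
      rw [show t + 1 - u = 1 + (t - u) by ring, zpow_add₀ two_ne_zero, zpow_one]
    refine (srtDelta_nonneg_iff ..).mpr ⟨2 * m, ?_, ?_⟩ <;> rw [hc] <;> push_cast <;> linarith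
  · intro d k hd hda hk hk'
    have hpow : (2 : ℤ) ^ u.toNat = 2 * 2 ^ (u - 1).toNat := by
      rw [show u.toNat = (u - 1).toNat + 1 by lia, pow_succ']
    have hpow' : (2 : ℤ) ^ (u + 1).toNat = 2 * 2 ^ u.toNat := by
      rw [show (u + 1).toNat = u.toNat + 1 by lia, pow_succ']
    obtain ⟨m, h₁, h₂⟩ := (srtDelta_nonneg_iff ..).mp
      (hvalid d (k / 2) hd hda (by lia) (by lia))
    have hc : (2 : ℝ) ^ (t - (u + 1)) = 2 ^ (t - u) / 2 := by
      rw [show t - (u + 1) = t - u - 1 by ring, zpow_sub_one₀ two_ne_zero, div_eq_mul_inv]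
    have hd' : (1 : ℝ) ≤ d := by exact_mod_cast hd
    have hc₀ : (0 : ℝ) < 2 ^ (t - u) := by positivity
    have hlow : 0 ≤ (2 : ℝ) ^ (t - u) * (d - ρ) := mul_nonneg hc₀.le (by linarith)
    have hupp : 0 ≤ (2 : ℝ) ^ (t - u) * (d + ρ - 1) := mul_nonneg hc₀.le (by linarith)
    have hk₁ : (k : ℝ) + 1 ≤ 2 * ((k / 2 : ℤ) + 1) := by
      exact_mod_cast (by lia : k + 1 ≤ 2 * (k / 2 + 1))
    have hk₂ : 2 * ((k / 2 : ℤ) : ℝ) ≤ k := by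
      exact_mod_cast (by lia : 2 * (k / 2) ≤ k)
    refine (srtDelta_nonneg_iff ..).mpr ⟨m, ?_, ?_⟩ <;> rw [hc]
    · linarith [mul_le_mul_of_nonneg_left hk₁ hlow]
    · linarith [mul_le_mul_of_nonneg_left hk₂ hupp]
end
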